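/- The supremum over all nonzero symmetric n × n real matrices A of the ratio ‖𝒯_n(A)‖_opr / ‖A‖_opr tends to infinity as n → ∞. Equivalently, for every c > 0 there exists n and a symmetric n × n real matrix A with A ≠ 0 and ‖𝒯_n(A)‖_opr > c·‖A‖_opr. -/

import Mathlib

open MeasureTheory Filter

/-- The `ℓ² → ℓ²` operator norm of an `n × n` real matrix:
`sup_{‖x‖₂ ≤ 1} ‖Ax‖₂`. -/
noncomputable def oprNorm {n : ℕ} (A : Matrix (Fin n) (Fin n) ℝ) : ℝ :=
  sSup {r : ℝ | ∃ x : Fin n → ℝ, (∑ j, (x j) ^ 2) ≤ 1 ∧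
    r = Real.sqrt (∑ i, (∑ j, A i j * x j) ^ 2)}
/-- Triangular cut `𝒯_n(A) = A ∘ T_n`, where `(T_n)_{ij} = 1` if `i ≥ j` and `0` if `i < j`:
entries with `i < j` are set to zero. -/
def tri {n : ℕ} (A : Matrix (Fin n) (Fin n) ℝ) : Matrix (Fin n) (Fin n) ℝ :=
  fun i j => if j ≤ i then A i j else 0

open Finset in
theorem sqrt_sum_sq_mulVec_le {n : ℕ} (A : Matrix (Fin n) (Fin n) ℝ) {x : Fin n → ℝ}
    (hx : ∑ j, (x j) ^ 2 ≤ 1) :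
    Real.sqrt (∑ i, (∑ j, A i j * x j) ^ 2) ≤ Real.sqrt (∑ i, ∑ j, A i j ^ 2) := by
  refine Real.sqrt_le_sqrt (sum_le_sum fun i _ => ?_)
  refine (sum_mul_sq_le_sq_mul_sq univ (A i) x).trans ?_
  exact mul_le_of_le_one_right (sum_nonneg fun _ _ => sq_nonneg _) hx

theorem sqrt_sum_sq_mulVec_le_oprNorm {n : ℕ} (A : Matrix (Fin n) (Fin n) ℝ) {x : Fin n → ℝ}
    (hx : ∑ j, (x j) ^ 2 ≤ 1) :
    Real.sqrt (∑ i, (∑ j, A i j * x j) ^ 2) ≤ oprNorm A := by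
  refine le_csSup ⟨Real.sqrt (∑ i, ∑ j, A i j ^ 2), ?_⟩ ⟨x, hx, rfl⟩
  rintro r ⟨y, hy, rfl⟩
  exact sqrt_sum_sq_mulVec_le A hy

theorem oprNorm_le {n : ℕ} (A : Matrix (Fin n) (Fin n) ℝ) {C : ℝ}
    (h : ∀ x : Fin n → ℝ, ∑ j, (x j) ^ 2 ≤ 1 → Real.sqrt (∑ i, (∑ j, A i j * x j) ^ 2) ≤ C) :
    oprNorm A ≤ C := by
  refine csSup_le ⟨_, 0, by simp, rfl⟩ ?_
  rintro r ⟨x, hx, rfl⟩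
  exact h x hx

theorem abs_entry_le_oprNorm {n : ℕ} (A : Matrix (Fin n) (Fin n) ℝ) (i j : Fin n) :
    |A i j| ≤ oprNorm A := by
  refine le_trans ?_ (sqrt_sum_sq_mulVec_le_oprNorm A (x := Pi.single j 1) ?_)
  · refine Real.abs_le_sqrt ?_
    refine le_trans (le_of_eq ?_) (Finset.single_le_sum
      (f := fun i => (∑ k, A i k * (Pi.single j 1 : Fin n → ℝ) k) ^ 2)
      (fun _ _ => sq_nonneg _) (Finset.mem_univ i))
    simp [Pi.single_apply]
  · simp [Pi.single_apply]

theorem oprNorm_pos {n : ℕ} {A : Matrix (Fin n) (Fin n) ℝ} (hA : A ≠ 0) : 0 < oprNorm A := by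
  by_contra! h
  refine hA (Matrix.ext fun i j => ?_)
  exact abs_nonpos_iff.mp ((abs_entry_le_oprNorm A i j).trans h)

theorem oprNorm_tri_le {n : ℕ} {A : Matrix (Fin n) (Fin n) ℝ} (hA : A ≠ 0) :
    oprNorm (tri A) ≤ n * oprNorm A := by
  refine oprNorm_le _ fun x hx => (sqrt_sum_sq_mulVec_le _ hx).trans ?_
  refine Real.sqrt_le_iff.mpr ⟨mul_nonneg n.cast_nonneg (oprNorm_pos hA).le, ?_⟩
  calc ∑ i, ∑ j, tri A i j ^ 2 ≤ ∑ _i : Fin n, ∑ _j : Fin n, oprNorm A ^ 2 := by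
        refine Finset.sum_le_sum fun i _ => Finset.sum_le_sum fun j _ => ?_
        unfold tri
        split_ifs
        · exact sq_le_sq' (abs_le.mp (abs_entry_le_oprNorm A i j)).1
            (abs_le.mp (abs_entry_le_oprNorm A i j)).2
        · simpa using sq_nonneg (oprNorm A)
    _ = (n * oprNorm A) ^ 2 := by simp; ring

theorem bddAbove_triCut_ratio (n : ℕ) :
    BddAbove {r : ℝ | ∃ A : Matrix (Fin n) (Fin n) ℝ,
        A.IsSymm ∧ A ≠ 0 ∧ r = oprNorm (tri A) / oprNorm A} := by
  refine ⟨n, ?_⟩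
  rintro r ⟨A, -, hA, rfl⟩
  exact (div_le_iff₀ (oprNorm_pos hA)).mpr (oprNorm_tri_le hA)

/-- The kernel `k ↦ 1 / k` on odd integers, extended by zero to even integers. -/
noncomputable def oddRecip (k : ℤ) : ℝ := if Even k then 0 else 1 / k

theorem integral_sin_int_mul (k : ℤ) :
    ∫ θ in (0 : ℝ)..Real.pi, Real.sin (k * θ) = 2 * oddRecip k := by
  rcases eq_or_ne k 0 with rfl | hk
  · simp [oddRecip]
  · have hk' : (k : ℝ) ≠ 0 := by exact_mod_cast hk
    rw [intervalIntegral.integral_comp_mul_left (fun t => Real.sin t) hk', integral_sin,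
      Real.cos_int_mul_pi]
    unfold oddRecip
    split_ifs with h
    · simp [h.neg_one_zpow]
    · simp [(Int.not_even_iff_odd.mp h).neg_one_zpow]
      ring

theorem integral_cos_int_mul (k : ℤ) :
    ∫ θ in (0 : ℝ)..Real.pi, Real.cos (k * θ) = if k = 0 then Real.pi else 0 := by
  split_ifs with hk
  · simp [hk]
  · have hk' : (k : ℝ) ≠ 0 := by exact_mod_cast hk
    rw [intervalIntegral.integral_comp_mul_left (fun t => Real.cos t) hk', integral_cos,
      Real.sin_int_mul_pi]
    simp

theorem integral_sq_trigSum {n : ℕ} (x : Fin n → ℝ) :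
    ∫ θ in (0 : ℝ)..Real.pi, ((∑ j, x j * Real.cos (j * θ)) ^ 2 +
      (∑ j, x j * Real.sin (j * θ)) ^ 2) = Real.pi * ∑ j, x j ^ 2 := by
  have h : ∀ θ : ℝ, (∑ j, x j * Real.cos (j * θ)) ^ 2 + (∑ j, x j * Real.sin (j * θ)) ^ 2 =
      ∑ i, ∑ j, x i * x j * Real.cos (((i : ℤ) - (j : ℤ) : ℤ) * θ) := by
    intro θ
    rw [sq, sq, Finset.sum_mul_sum, Finset.sum_mul_sum, ← Finset.sum_add_distrib]
    refine Finset.sum_congr rfl fun i _ => ?_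
    rw [← Finset.sum_add_distrib]
    refine Finset.sum_congr rfl fun j _ => ?_
    push_cast
    rw [sub_mul, Real.cos_sub]
    ring
  simp_rw [h]
  rw [intervalIntegral.integral_finsetSum
    fun i _ => (Continuous.intervalIntegrable (by fun_prop) _ _)]
  rw [Finset.mul_sum]
  refine Finset.sum_congr rfl fun i _ => ?_
  rw [intervalIntegral.integral_finsetSum
    fun i _ => (Continuous.intervalIntegrable (by fun_prop) _ _)]
  simp_rw [intervalIntegral.integral_const_mul, integral_cos_int_mul]
  rw [Finset.sum_eq_single i]
  · simp; ring
  · intro j _ hj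
    rw [if_neg, mul_zero]
    intro h0
    exact hj (Fin.ext (by omega))
  · simp

theorem sum_oddRecip_bilin_le {n : ℕ} (x y : Fin n → ℝ) :
    ∑ i : Fin n, ∑ j : Fin n, y i * oddRecip (i - j) * x j ≤
      Real.pi / 4 * (∑ j, x j ^ 2 + ∑ j, y j ^ 2) := by
  set C : (Fin n → ℝ) → ℝ → ℝ := fun x θ => ∑ j, x j * Real.cos (j * θ) with hC
  set S : (Fin n → ℝ) → ℝ → ℝ := fun x θ => ∑ j, x j * Real.sin (j * θ) with hS
  have hCc : ∀ x, Continuous (C x) := fun x => by fun_prop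
  have hSc : ∀ x, Continuous (S x) := fun x => by fun_prop
  have key : ∫ θ in (0 : ℝ)..Real.pi, (S y θ * C x θ - C y θ * S x θ) =
      2 * ∑ i : Fin n, ∑ j : Fin n, y i * oddRecip (i - j) * x j := by
    have h : ∀ θ : ℝ, S y θ * C x θ - C y θ * S x θ =
        ∑ i, ∑ j, y i * x j * Real.sin (((i : ℤ) - (j : ℤ) : ℤ) * θ) := by
      intro θ
      simp only [hC, hS]
      rw [Finset.sum_mul_sum, Finset.sum_mul_sum, ← Finset.sum_sub_distrib]
      refine Finset.sum_congr rfl fun i _ => ?_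
      rw [← Finset.sum_sub_distrib]
      refine Finset.sum_congr rfl fun j _ => ?_
      push_cast
      rw [sub_mul, Real.sin_sub]
      ring
    simp_rw [h]
    rw [intervalIntegral.integral_finsetSum
      fun i _ => (Continuous.intervalIntegrable (by fun_prop) _ _), Finset.mul_sum]
    refine Finset.sum_congr rfl fun i _ => ?_
    rw [intervalIntegral.integral_finsetSum
      fun i _ => (Continuous.intervalIntegrable (by fun_prop) _ _), Finset.mul_sum]
    refine Finset.sum_congr rfl fun j _ => ?_
    rw [intervalIntegral.integral_const_mul, integral_sin_int_mul]
    ring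
  have hle : ∫ θ in (0 : ℝ)..Real.pi, (S y θ * C x θ - C y θ * S x θ) ≤
      ∫ θ in (0 : ℝ)..Real.pi,
        1 / 2 * ((C x θ ^ 2 + S x θ ^ 2) + (C y θ ^ 2 + S y θ ^ 2)) := by
    refine intervalIntegral.integral_mono_on Real.pi_pos.le
      (Continuous.intervalIntegrable (by fun_prop) _ _)
      (Continuous.intervalIntegrable (by fun_prop) _ _) fun θ _ => ?_
    nlinarith [sq_nonneg (S y θ - C x θ), sq_nonneg (C y θ + S x θ)]
  rw [key, intervalIntegral.integral_const_mul, intervalIntegral.integral_add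
    (Continuous.intervalIntegrable (by fun_prop) _ _)
    (Continuous.intervalIntegrable (by fun_prop) _ _),
    integral_sq_trigSum, integral_sq_trigSum] at hle
  linarith

/-- A symmetric signed variant of the Hilbert matrix. -/
noncomputable def signedHilbert (n : ℕ) : Matrix (Fin n) (Fin n) ℝ :=
  fun i j => oddRecip (i - j) * (-1) ^ (j : ℕ)

theorem signedHilbert_isSymm (n : ℕ) : (signedHilbert n).IsSymm := by
  refine Matrix.IsSymm.ext fun i j => ?_
  unfold signedHilbert oddRecip
  by_cases h : Even ((i : ℤ) - j)
  · have h' : Even ((j : ℤ) - i) := by rw [← neg_sub]; exact h.neg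
    simp [h, h']
  · have h' : ¬ Even ((j : ℤ) - i) := by rw [← neg_sub, even_neg]; exact h
    rw [if_neg h, if_neg h']
    have hs : ((-1 : ℝ)) ^ (i : ℕ) = -(-1) ^ (j : ℕ) := by
      rcases Nat.even_or_odd (i : ℕ) with hi | hi <;> rcases Nat.even_or_odd (j : ℕ) with hj | hj
      · exact absurd (by grind) h
      · simp [hi.neg_one_pow, hj.neg_one_pow]
      · simp [hi.neg_one_pow, hj.neg_one_pow]
      · exact absurd (by grind) h
    rw [hs, ← neg_sub (i : ℤ) j]
    push_cast
    rw [one_div, one_div, inv_neg]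
    ring

theorem signedHilbert_ne_zero {n : ℕ} (hn : 2 ≤ n) : signedHilbert n ≠ 0 := by
  intro h
  have := congrFun (congrFun h ⟨1, by omega⟩) ⟨0, by omega⟩
  simp [signedHilbert, oddRecip] at this

theorem oprNorm_signedHilbert_le (n : ℕ) : oprNorm (signedHilbert n) ≤ Real.pi / 2 := by
  refine oprNorm_le _ fun x hx => ?_
  set z : Fin n → ℝ := fun i => ∑ j, signedHilbert n i j * x j with hz
  set r := Real.sqrt (∑ i, z i ^ 2) with hr
  have hr2 : r ^ 2 = ∑ i, z i ^ 2 := Real.sq_sqrt (Finset.sum_nonneg fun _ _ => sq_nonneg _)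
  rcases (Real.sqrt_nonneg (∑ i, z i ^ 2)).eq_or_lt with h0 | hpos
  · rw [hr, ← h0]; positivity
  rw [← hr] at hpos
  have h := sum_oddRecip_bilin_le (fun j => (-1) ^ (j : ℕ) * x j) (fun i => z i / r)
  have h1 : ∑ i : Fin n, ∑ j : Fin n, z i / r * oddRecip (i - j) * ((-1) ^ (j : ℕ) * x j) = r := by
    have : ∀ i : Fin n, ∑ j : Fin n, z i / r * oddRecip (i - j) * ((-1) ^ (j : ℕ) * x j) =
        z i ^ 2 / r := by
      intro i
      have : z i ^ 2 / r = z i / r * ∑ j, signedHilbert n i j * x j := by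
        rw [← show z i = ∑ j, signedHilbert n i j * x j from rfl]; ring
      rw [this, Finset.mul_sum]
      refine Finset.sum_congr rfl fun j _ => ?_
      unfold signedHilbert
      ring
    simp_rw [this]
    rw [← Finset.sum_div, ← hr2]
    field_simp
  have h2 : ∑ j : Fin n, ((-1) ^ (j : ℕ) * x j) ^ 2 = ∑ j, x j ^ 2 := by
    refine Finset.sum_congr rfl fun j _ => ?_
    rw [mul_pow, ← pow_mul, mul_comm (j : ℕ), pow_mul]; simp
  have h3 : ∑ i, (z i / r) ^ 2 = 1 := by
    simp_rw [div_pow]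
    rw [← Finset.sum_div, ← hr2]
    field_simp
  rw [h1, h2, h3] at h
  nlinarith [Real.pi_pos]

theorem oddRecip_natCast_nonneg (k : ℕ) : 0 ≤ oddRecip k := by
  unfold oddRecip
  split_ifs <;> simp

theorem tendsto_sum_oddRecip :
    Tendsto (fun m : ℕ => ∑ k ∈ Finset.range m, oddRecip k) atTop atTop := by
  refine (not_summable_iff_tendsto_nat_atTop_of_nonneg oddRecip_natCast_nonneg).mp fun hs => ?_
  have h1 : Summable fun m : ℕ => oddRecip ((2 * m + 1 : ℕ) : ℤ) :=
    hs.comp_injective (i := fun m : ℕ => 2 * m + 1) fun a b h => by simpa using h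
  have h2 : Summable fun m : ℕ => 1 / 2 * (1 / ((m + 1 : ℕ) : ℝ)) := by
    refine h1.of_nonneg_of_le (fun m => by positivity) fun m => ?_
    rw [oddRecip, if_neg (by grind), one_div_mul_one_div]
    refine one_div_le_one_div_of_le (by positivity) ?_
    push_cast
    linarith
  refine Real.not_summable_one_div_natCast ?_
  refine (summable_nat_add_iff 1).mp ((summable_mul_left_iff (by norm_num : (1 / 2 : ℝ) ≠ 0)).mp h2)

theorem sum_tri_signedHilbert_mul {n : ℕ} (i : Fin n) (c : ℝ) :
    ∑ j, tri (signedHilbert n) i j * ((-1) ^ (j : ℕ) * c) =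
      c * ∑ k ∈ Finset.range (i + 1), oddRecip k := by
  have h : ∀ j : Fin n, tri (signedHilbert n) i j * ((-1) ^ (j : ℕ) * c) =
      (fun j : ℕ => if j ≤ (i : ℕ) then c * oddRecip ((i : ℤ) - j) else 0) j := by
    intro j
    have hs : ((-1 : ℝ) ^ (j : ℕ)) * (-1) ^ (j : ℕ) = 1 := by
      rw [← mul_pow]; simp
    simp only [tri, signedHilbert, Fin.le_def]
    split_ifs
    · linear_combination c * oddRecip ((i : ℤ) - j) * hs
    · simp
  simp_rw [h]
  rw [Fin.sum_univ_eq_sum_range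
    (fun j : ℕ => if j ≤ (i : ℕ) then c * oddRecip ((i : ℤ) - j) else 0), ← Finset.sum_filter]
  have hf : (Finset.range n).filter (fun j => j ≤ (i : ℕ)) = Finset.range (i + 1) := by
    ext j; simp; omega
  rw [hf, ← Finset.mul_sum, ← Finset.sum_range_reflect]
  congr 1
  refine Finset.sum_congr rfl fun j hj => ?_
  congr 1
  have := Finset.mem_range.mp hj
  omega

theorem le_oprNorm_tri_signedHilbert {m n : ℕ} (hn : 0 < n) (hmn : 2 * m ≤ n) :
    (∑ k ∈ Finset.range m, oddRecip k) / 2 ≤ oprNorm (tri (signedHilbert n)) := by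
  set h : ℕ → ℝ := fun m => ∑ k ∈ Finset.range m, oddRecip k with hh
  have hmono : Monotone h := fun a b hab => Finset.sum_le_sum_of_subset_of_nonneg
    (Finset.range_mono hab) fun k _ _ => oddRecip_natCast_nonneg k
  have h0 : 0 ≤ h m := Finset.sum_nonneg fun k _ => oddRecip_natCast_nonneg k
  have hn' : (0 : ℝ) < n := by exact_mod_cast hn
  have hc : (1 / Real.sqrt n) ^ 2 = 1 / n := by
    rw [div_pow, Real.sq_sqrt hn'.le, one_pow]
  refine le_trans ?_ (sqrt_sum_sq_mulVec_le_oprNorm _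
    (x := fun j : Fin n => (-1) ^ (j : ℕ) * (1 / Real.sqrt n)) ?_)
  · simp_rw [sum_tri_signedHilbert_mul, mul_pow, hc]
    refine Real.le_sqrt_of_sq_le ?_
    rw [← Finset.mul_sum, Fin.sum_univ_eq_sum_range (fun i : ℕ => h (i + 1) ^ 2)]
    have hsum : ((n - m : ℕ) : ℝ) * h m ^ 2 ≤ ∑ i ∈ Finset.range n, h (i + 1) ^ 2 := by
      calc ((n - m : ℕ) : ℝ) * h m ^ 2 = ∑ _i ∈ Finset.Ico m n, h m ^ 2 := by simp
        _ ≤ ∑ i ∈ Finset.Ico m n, h (i + 1) ^ 2 := by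
          refine Finset.sum_le_sum fun i hi => ?_
          have := hmono (show m ≤ i + 1 by have := (Finset.mem_Ico.mp hi).1; omega)
          gcongr
        _ ≤ _ := Finset.sum_le_sum_of_subset_of_nonneg
          (fun i hi => Finset.mem_range.mpr (Finset.mem_Ico.mp hi).2) fun _ _ _ => sq_nonneg _
    rw [Nat.cast_sub (by omega)] at hsum
    have hmn' : 2 * (m : ℝ) ≤ n := by exact_mod_cast hmn
    rw [one_div_mul_eq_div, le_div_iff₀ hn']
    change (h m / 2) ^ 2 * n ≤ _
    nlinarith [mul_le_mul_of_nonneg_right hmn' (sq_nonneg (h m)), mul_nonneg hn'.le (sq_nonneg (h m))]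
  · refine le_of_eq ?_
    have : ∀ j : Fin n, ((-1) ^ (j : ℕ) * (1 / Real.sqrt n)) ^ 2 = 1 / (n : ℝ) := fun j => by
      rw [mul_pow, hc, ← pow_mul, mul_comm (j : ℕ), pow_mul]; simp
    simp_rw [this]
    simp [hn'.ne']

/-- `sup_{A ∈ Sₙ(ℝ), A ≠ 0} ‖𝒯ₙ(A)‖_opr / ‖A‖_opr → ∞` as `n → ∞`,
where the supremum is over symmetric matrices. -/
theorem triCut_oprNorm_unbounded_symm :
    Tendsto
      (fun n : ℕ => sSup {r : ℝ | ∃ A : Matrix (Fin n) (Fin n) ℝ,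
        A.IsSymm ∧ A ≠ 0 ∧ r = oprNorm (tri A) / oprNorm A})
      atTop atTop := by
  refine tendsto_atTop.mpr fun b => ?_
  obtain ⟨m, hm⟩ := (tendsto_sum_oddRecip.eventually_ge_atTop (|b| * Real.pi)).exists
  filter_upwards [eventually_ge_atTop (2 * m + 2)] with n hn
  have hA := signedHilbert_ne_zero (show 2 ≤ n by omega)
  refine le_trans ?_ (le_csSup (bddAbove_triCut_ratio n)
    ⟨signedHilbert n, signedHilbert_isSymm n, hA, rfl⟩)
  refine (le_abs_self b).trans ((le_div_iff₀ (oprNorm_pos hA)).mpr ?_)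
  calc |b| * oprNorm (signedHilbert n) ≤ |b| * (Real.pi / 2) := by
        gcongr; exact oprNorm_signedHilbert_le n
    _ ≤ (∑ k ∈ Finset.range m, oddRecip k) / 2 := by linarith
    _ ≤ _ := le_oprNorm_tri_signedHilbert (by omega) (by omega)
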